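/- arXiv:1108.1888 — 2 statements merged into one kernel-verified Lean document; each statement's English description precedes it below -/
import Mathlib

section
/- Let h : ℂ → ℂ be an entire function. Suppose that for every real number t the equation h(z) = i·t has exactly one solution z ∈ ℂ. Then h is a non-constant affine function: there exist complex numbers a, b with a ≠ 0 such that h(z) = a·z + b for all z ∈ ℂ. -/
open MeasureTheory Real Set Filter Topology Metric

/-- integrability of the logarithmic kernel in the segment parameter -/
lemma seg_intervalIntegrable (w : ℂ) :
    IntervalIntegrable (fun t : ℝ => log ‖w - Complex.I * t‖) volume 0 1 := by
  apply MeromorphicOn.intervalIntegrable_log_norm (f := fun t : ℝ => w - Complex.I * t)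
  intro t _
  apply AnalyticAt.meromorphicAt
  have : AnalyticAt ℝ (fun t : ℝ => (t : ℂ)) t := Complex.ofRealCLM.analyticAt t
  fun_prop

/-- the logarithmic potential of the segment is bounded below by `log⁺ - C` -/
lemma seg_lower : ∃ C : ℝ, ∀ w : ℂ,
    log⁺ ‖w‖ - C ≤ ∫ t in (0:ℝ)..1, log ‖w - Complex.I * t‖ := by
  have hcont : Continuous (fun y : ℝ => y * log y - (y - 1) * log (y - 1) - y + (y - 1)) := by
    have h1 := Real.continuous_mul_log
    have h2 : Continuous fun y : ℝ => (y - 1) * log (y - 1) :=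
      h1.comp (continuous_id.sub continuous_const)
    fun_prop
  obtain ⟨m, hm⟩ := (isCompact_Icc (a := (-2:ℝ)) (b := 2)).bddBelow_image hcont.continuousOn
  refine ⟨max (log 2) (log 2 - m), fun w => ?_⟩
  rcases le_total 2 ‖w‖ with hw | hw
  · have h1 : log⁺ ‖w‖ = log ‖w‖ := posLog_eq_log (by rw [abs_norm]; linarith)
    have h2 : (∫ t in (0:ℝ)..1, (log ‖w‖ - log 2)) ≤
        ∫ t in (0:ℝ)..1, log ‖w - Complex.I * t‖ := by
      apply intervalIntegral.integral_mono_on zero_le_one _root_.intervalIntegrable_const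
        (seg_intervalIntegrable w)
      intro t ht
      rw [← Real.log_div (by linarith) (by norm_num)]
      apply Real.log_le_log (by linarith)
      have := norm_sub_norm_le w (Complex.I * t)
      have h3 : ‖Complex.I * (t:ℂ)‖ ≤ 1 := by
        simp [abs_of_nonneg ht.1, ht.2]
      linarith
    simp at h2
    have := le_max_left (log 2) (log 2 - m)
    linarith
  · have h1 : log⁺ ‖w‖ ≤ log 2 := by
      have := posLog_le_posLog (norm_nonneg w) hw
      rwa [posLog_eq_log (x := 2) (by norm_num)] at this
    have him : |w.im| ≤ 2 := (Complex.abs_im_le_norm w).trans hw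
    have h3 := hm (mem_image_of_mem _ (show w.im ∈ Icc (-2:ℝ) 2 from ⟨by linarith [neg_abs_le w.im], by linarith [le_abs_self w.im]⟩))
    have h2 : (∫ t in (0:ℝ)..1, log (w.im - t)) ≤
        ∫ t in (0:ℝ)..1, log ‖w - Complex.I * t‖ := by
      apply intervalIntegral.integral_mono_ae zero_le_one _ (seg_intervalIntegrable w)
      · have : ∀ᵐ t : ℝ, t ≠ w.im := by simp [ae_iff, measure_singleton]
        filter_upwards [this] with t ht
        rw [← Real.log_abs]
        apply Real.log_le_log (by rw [abs_pos]; intro h; apply ht; linarith)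
        have := Complex.abs_im_le_norm (w - Complex.I * t)
        simpa using this
      · have := (intervalIntegral.intervalIntegrable_log' (a := w.im - 0) (b := w.im - 1)).comp_sub_left w.im
        simpa using this
    rw [intervalIntegral.integral_comp_sub_left (fun x => log x) w.im, integral_log] at h2
    have := le_max_right (log 2) (log 2 - m)
    simp only [sub_zero] at h2
    linarith

/-- Averaging Jensen-type bounds over the segment. -/
lemma avg_bound : ∃ C : ℝ, ∀ (h : ℂ → ℂ) (_ : Continuous h) (c : ℂ) (R K : ℝ),
    (CircleIntegrable (fun z => log⁺ ‖h z‖) c R) →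
    (∀ᵐ t : ℝ, t ∈ Ioc (0 : ℝ) 1 → circleAverage (fun z => log ‖h z - Complex.I * t‖) c R ≤ K) →
    circleAverage (fun z => log⁺ ‖h z‖) c R ≤ K + C := by
  obtain ⟨C, hC⟩ := seg_lower
  refine ⟨C, fun h hc c R K hI hK => ?_⟩
  set F : ℝ → ℝ → ℝ := fun θ t => log ‖h (circleMap c R θ) - Complex.I * t‖ with hF
  let ν : Measure ℝ := volume.restrict (Ioc 0 (2 * π))
  let μ : Measure ℝ := volume.restrict (Ioc 0 1)
  have hcc : Continuous (fun θ => h (circleMap c R θ)) := hc.comp (continuous_circleMap c R)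
  obtain ⟨M, hM⟩ : ∃ M : ℝ, ∀ θ, ‖h (circleMap c R θ)‖ ≤ M := by
    obtain ⟨M, hM⟩ := (isCompact_sphere c |R|).exists_bound_of_continuousOn hc.continuousOn
    exact ⟨M, fun θ => hM _ (circleMap_mem_sphere' c R θ)⟩
  have hmeas : Measurable (Function.uncurry F) := by
    apply Real.measurable_log.comp
    apply Continuous.measurable
    have : Continuous fun p : ℝ × ℝ => h (circleMap c R p.1) := hcc.comp continuous_fst
    fun_prop
  have hFt : ∀ θ, Integrable (F θ) μ := fun θ => by
    have := seg_intervalIntegrable (h (circleMap c R θ))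
    rwa [intervalIntegrable_iff_integrableOn_Ioc_of_le zero_le_one] at this
  have hlow : ∀ θ, log⁺ ‖h (circleMap c R θ)‖ - C ≤ ∫ t, F θ t ∂μ := fun θ => by
    have := hC (h (circleMap c R θ))
    rwa [intervalIntegral.integral_of_le zero_le_one] at this
  have hint : Integrable (Function.uncurry F) (ν.prod μ) := by
    rw [integrable_prod_iff hmeas.aestronglyMeasurable]
    refine ⟨Eventually.of_forall hFt, ?_⟩
    apply Integrable.of_bound (C := 2 * log⁺ (M + 1) + C)
    · exact (hmeas.aestronglyMeasurable.norm.integral_prod_right')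
    · refine Eventually.of_forall fun θ => ?_
      rw [Real.norm_of_nonneg (integral_nonneg fun t => norm_nonneg _)]
      have h1 : (∫ t, ‖F θ t‖ ∂μ) ≤ ∫ t, (2 * log⁺ (M + 1) - F θ t) ∂μ := by
        apply integral_mono_ae (hFt θ).norm ((integrable_const _).sub (hFt θ))
        filter_upwards [ae_restrict_mem measurableSet_Ioc] with t ht
        have h2 : F θ t ≤ log⁺ (M + 1) := by
          refine (le_max_right 0 _).trans (posLog_le_posLog (norm_nonneg _) ?_)
          refine (norm_sub_le _ _).trans ?_
          have : ‖Complex.I * (t:ℂ)‖ ≤ 1 := by simp [abs_of_nonneg ht.1.le, ht.2]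
          linarith [hM θ]
        have h3 : 0 ≤ log⁺ (M + 1) := posLog_nonneg
        rw [Real.norm_eq_abs, abs_le]
        simp only [Pi.sub_apply]
        constructor <;> linarith
      rw [integral_sub (integrable_const _) (hFt θ)] at h1
      have h4 := hlow θ
      have h5 : 0 ≤ log⁺ ‖h (circleMap c R θ)‖ := posLog_nonneg
      simp [μ] at h1
      simp only [μ] at h4
      simp only [Function.uncurry, Real.norm_eq_abs, μ]
      linarith
  have hswap := integral_integral_swap hint
  have hI' : Integrable (fun θ => log⁺ ‖h (circleMap c R θ)‖) ν := by
    have : IntervalIntegrable _ _ _ _ := hI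
    rwa [intervalIntegrable_iff_integrableOn_Ioc_of_le two_pi_pos.le] at this
  have h1 : (∫ θ, (log⁺ ‖h (circleMap c R θ)‖ - C) ∂ν) ≤ ∫ θ, ∫ t, F θ t ∂μ ∂ν := by
    apply integral_mono (hI'.sub (integrable_const _)) hint.integral_prod_left hlow
  have h2 : (∫ t, ∫ θ, F θ t ∂ν ∂μ) ≤ ∫ t, (2 * π * K) ∂μ := by
    apply integral_mono_ae hint.integral_prod_right (integrable_const _)
    filter_upwards [ae_restrict_of_ae hK, ae_restrict_mem measurableSet_Ioc] with t ht htI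
    replace ht := ht htI
    rw [circleAverage, intervalIntegral.integral_of_le two_pi_pos.le, smul_eq_mul,
      inv_mul_le_iff₀ two_pi_pos] at ht
    exact ht
  rw [integral_sub hI' (integrable_const _)] at h1
  rw [circleAverage, intervalIntegral.integral_of_le two_pi_pos.le, smul_eq_mul,
      inv_mul_le_iff₀ two_pi_pos]
  rw [hswap] at h1
  have h3 := h1.trans h2
  simp [ν, μ, two_pi_pos.le] at h3
  linarith

/-- A zero-free entire function whose circle averages of `log⁺` grow at most logarithmically
is constant. -/
lemma const_of_log_growth (f : ℂ → ℂ) (hf : Differentiable ℂ f) (hne : ∀ z, f z ≠ 0) (c : ℂ)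
    (K R₀ : ℝ)
    (hK : ∀ R, R₀ ≤ R → circleAverage (fun z => log⁺ ‖f z‖) c R ≤ log R + K) :
    ∀ z, f z = f c := by
  have han : ∀ z, AnalyticAt ℂ f z := fun z => hf.analyticAt z
  have hcont : Continuous (fun z => log ‖f z‖) :=
    hf.continuous.norm.log (fun z => norm_ne_zero_iff.mpr (hne z))
  have hharm : ∀ s, InnerProductSpace.HarmonicOnNhd (fun z => log ‖f z‖) s := fun s z _ =>
    (han z).harmonicAt_log_norm (hne z)
  have key : ∀ w, log ‖f w‖ = log ‖f c‖ := by
    intro w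
    set r := ‖w - c‖ with hr
    have hr0 : 0 ≤ r := norm_nonneg _
    have hbd : ∀ R, max R₀ (r + 1) ≤ R → |log ‖f w‖ - log ‖f c‖| ≤
        2 * r / (R - r) * (2 * (log R + K) - log ‖f c‖) := by
      intro R hR
      have hR1 : R₀ ≤ R := (le_max_left _ _).trans hR
      have hR2 : r + 1 ≤ R := (le_max_right _ _).trans hR
      have hRpos : 0 < R := by linarith
      have hw : w ∈ ball c R := by rw [mem_ball_iff_norm]; linarith
      have hP := (hharm (closedBall c R)).circleAverage_re_herglotzRieszKernel_smul hw
      have hM : circleAverage (fun z => log ‖f z‖) c R = log ‖f c‖ :=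
        (hharm (closedBall c |R|)).circleAverage_eq
      have hkc : ContinuousOn (Complex.re ∘ herglotzRieszKernel c w) (sphere c |R|) :=
        Complex.continuous_re.comp_continuousOn (continuousOn_herglotzRieszKernel_sphere hw)
      have hci : ∀ g : ℂ → ℝ, ContinuousOn g (sphere c |R|) → CircleIntegrable g c R :=
        fun g hg => ContinuousOn.circleIntegrable' hg
      have hi1 := hci _ hcont.continuousOn
      have hi2 : CircleIntegrable ((Complex.re ∘ herglotzRieszKernel c w) •
        fun z => log ‖f z‖) c R := hci _ (hkc.smul hcont.continuousOn)
      have hi3 : CircleIntegrable (fun z => log⁺ ‖f z‖) c R := by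
        apply hci
        apply Continuous.continuousOn
        simp only [posLog_apply]
        exact continuous_const.max hcont
      have habs : circleAverage (fun z => |log ‖f z‖|) c R ≤ 2 * (log R + K) - log ‖f c‖ := by
        have e : (fun z => |log ‖f z‖|) = fun z => (2 : ℝ) • log⁺ ‖f z‖ - log ‖f z‖ := by
          funext z
          rw [← half_mul_log_add_log_abs]
          simp only [smul_eq_mul]
          ring
        have hi4 : CircleIntegrable (fun z => (2 : ℝ) • log⁺ ‖f z‖) c R := hi3.const_smul
        rw [e, circleAverage_fun_sub hi4 hi1, circleAverage_fun_smul, hM]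
        have := hK R hR1
        simp only [smul_eq_mul]
        linarith
      rw [← hP, ← hM, ← circleAverage_sub hi2 hi1]
      refine abs_circleAverage_le_circleAverage_abs.trans ?_
      rw [hM]
      refine le_trans ?_ (mul_le_mul_of_nonneg_left habs (by
        apply div_nonneg <;> linarith))
      rw [← smul_eq_mul, ← circleAverage_fun_smul]
      apply circleAverage_mono (hi2.sub hi1).abs
      · exact hci _ (hcont.abs.const_smul (2 * r / (R - r))).continuousOn
      intro z hz
      rw [abs_of_pos hRpos] at hz
      have u := re_herglotzRieszKernel_le hz hw
      have l := le_re_herglotzRieszKernel hz hw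
      rw [← hr] at u l
      change |((z - c + (w - c)) / (z - c - (w - c))).re * log ‖f z‖ - log ‖f z‖| ≤
        2 * r / (R - r) * |log ‖f z‖|
      rw [← sub_one_mul, abs_mul]
      apply mul_le_mul_of_nonneg_right _ (abs_nonneg _)
      rw [abs_le]
      have e1 : (R + r) / (R - r) = 1 + 2 * r / (R - r) := by
        field_simp [show R - r ≠ 0 by linarith]; ring
      have e2 : (R - r) / (R + r) = 1 - 2 * r / (R + r) := by
        field_simp [show R + r ≠ 0 by linarith]; ring
      have e3 : 2 * r / (R + r) ≤ 2 * r / (R - r) := by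
        apply div_le_div_of_nonneg_left <;> linarith
      constructor <;> linarith
    have hlim : Tendsto (fun R : ℝ => 2 * r / (R - r) * (2 * (log R + K) - log ‖f c‖))
        atTop (𝓝 0) := by
      have t1 : Tendsto (fun R : ℝ => R - r) atTop atTop :=
        tendsto_atTop_add_const_right _ _ tendsto_id
      have o1 : (fun R : ℝ => 2 * (log R + K) - log ‖f c‖) =o[atTop] (fun R : ℝ => R) := by
        have a1 := Real.isLittleO_log_id_atTop
        have a2 : (fun _ : ℝ => 2 * K - log ‖f c‖) =o[atTop] (fun R : ℝ => R) :=
          Asymptotics.isLittleO_const_id_atTop _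
        refine ((a1.const_mul_left 2).add a2).congr_left fun R => by ring
      have O2 : (fun R : ℝ => 2 * r / (R - r)) =O[atTop] (fun R : ℝ => R⁻¹) := by
        apply Asymptotics.IsBigO.of_bound (4 * r)
        filter_upwards [eventually_ge_atTop (2 * r + 1)] with R hR
        have : 0 < R := by linarith
        have h' : 0 < R - r := by linarith
        rw [Real.norm_of_nonneg (by positivity), Real.norm_of_nonneg (by positivity),
          ← div_eq_mul_inv, div_le_div_iff₀ h' this]
        nlinarith
      have o3 := O2.mul_isLittleO o1
      have : (fun R : ℝ => R⁻¹ * R) =ᶠ[atTop] fun _ => (1:ℝ) := by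
        filter_upwards [eventually_gt_atTop 0] with R hR
        field_simp
      exact (Asymptotics.isLittleO_one_iff ℝ).mp (o3.congr' (EventuallyEq.refl _ _) this)
    have : |log ‖f w‖ - log ‖f c‖| ≤ 0 := by
      apply ge_of_tendsto hlim
      filter_upwards [eventually_ge_atTop (max R₀ (r + 1))] with R hR using hbd R hR
    have := abs_nonpos_iff.mp this
    linarith
  intro z
  apply hf.apply_eq_apply_of_bounded
  rw [isBounded_iff_forall_norm_le]
  refine ⟨‖f c‖, ?_⟩
  rintro _ ⟨w, rfl⟩
  exact (Real.log_injOn_pos (norm_pos_iff.mpr (hne w)) (norm_pos_iff.mpr (hne c)) (key w)).le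

/-- Dividing out a simple unique zero. -/
lemma factor (h : ℂ → ℂ) (hd : Differentiable ℂ h) (a v : ℂ) (ha : h a = v)
    (hu : ∀ z, h z = v → z = a) (hda : deriv h a ≠ 0) :
    ∃ f : ℂ → ℂ, Differentiable ℂ f ∧ (∀ z, f z ≠ 0) ∧ ∀ z, h z - v = (z - a) * f z := by
  have e : ∀ z, h z - v = (z - a) * dslope h a z := fun z => by
    rw [← smul_eq_mul, sub_smul_dslope, ha]
  refine ⟨dslope h a, ?_, ?_, e⟩
  · rw [← differentiableOn_univ, Complex.differentiableOn_dslope univ_mem]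
    exact hd.differentiableOn
  · intro z hz
    by_cases hza : z = a
    · subst hza
      rw [dslope_same] at hz
      exact hda hz
    · have := e z
      rw [hz, mul_zero, sub_eq_zero] at this
      exact hza (hu z this)

/-- Jensen bound for a function with a unique simple zero. -/
lemma jensen_bound (h : ℂ → ℂ) (hd : Differentiable ℂ h) (a v c : ℂ) (ha : h a = v)
    (hu : ∀ z, h z = v → z = a) (hda : deriv h a ≠ 0) (δ R : ℝ) (hδ : 0 < δ)
    (hδa : δ ≤ ‖c - a‖) (hR : δ ≤ R) :
    circleAverage (fun z => log ‖h z - v‖) c R ≤ log ‖h c - v‖ - log δ + log R := by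
  obtain ⟨f, hfd, hf0, hf⟩ := factor h hd a v ha hu hda
  have hR0 : 0 < R := hδ.trans_le hR
  have hca : 0 < ‖c - a‖ := hδ.trans_le hδa
  have i1 : CircleIntegrable (fun z => log ‖z - a‖) c R := by
    apply MeromorphicOn.circleIntegrable_log_norm (f := fun z => z - a)
    intro z _
    fun_prop
  have i2 : CircleIntegrable (fun z => log ‖f z‖) c R := by
    apply MeromorphicOn.circleIntegrable_log_norm
    intro z _
    exact (hfd.analyticAt z).meromorphicAt
  have e : circleAverage (fun z => log ‖h z - v‖) c R
      = circleAverage (fun z => log ‖z - a‖ + log ‖f z‖) c R := by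
    apply circleAverage_congr_codiscreteWithin _ hR0.ne'
    filter_upwards [compl_singleton_mem_codiscreteWithin a] with z hz
    rw [hf, norm_mul, Real.log_mul (by simpa [sub_eq_zero] using hz) (by simpa using hf0 z)]
  have e2 : circleAverage (fun z => log ‖f z‖) c R = log ‖f c‖ :=
    AnalyticOnNhd.circleAverage_log_norm_of_ne_zero (fun z _ => hfd.analyticAt z)
      (fun z _ => hf0 z)
  rw [e, circleAverage_fun_add i1 i2, e2,
    circleAverage_log_norm_sub_const_eq_log_radius_add_posLog hR0.ne', hf c, norm_mul,
    Real.log_mul hca.ne' (by simpa using hf0 c)]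
  have h1 := Real.log_le_log hδ hδa
  have h2 := Real.log_le_log hδ hR
  have h3 : log⁺ (R⁻¹ * ‖c - a‖) ≤ log ‖c - a‖ - log δ := by
    rw [posLog_apply, Real.log_mul (by positivity) hca.ne', Real.log_inv]
    apply max_le <;> linarith
  linarith

/-- If an entire function `h : ℂ → ℂ` takes each purely imaginary value `i·t`
(for `t : ℝ`) exactly once, then `h` is a non-constant affine function. -/
theorem entire_unique_imaginary_values_affine (h : ℂ → ℂ)
    (hdiff : Differentiable ℂ h)
    (huniq : ∀ t : ℝ, ∃! z : ℂ, h z = Complex.I * t) :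
    ∃ a b : ℂ, a ≠ 0 ∧ ∀ z : ℂ, h z = a * z + b := by
  choose g hg hgu using huniq
  have hginj : Function.Injective g := fun s t hst => by
    have := hg s
    rw [hst, hg t] at this
    simpa using this.symm
  -- a point whose value is off the imaginary axis
  obtain ⟨c, hc⟩ : ∃ c, (h c).re ≠ 0 := by
    by_contra! hre
    have hb : Differentiable ℂ (fun z => Complex.exp (h z)) := hdiff.cexp
    have := hb.apply_eq_apply_of_bounded (by
      rw [isBounded_iff_forall_norm_le]
      refine ⟨1, ?_⟩
      rintro _ ⟨w, rfl⟩
      simp [Complex.norm_exp, hre w]) (g 0) (g π)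
    simp only [hg] at this
    rw [mul_comm Complex.I (π : ℂ), Complex.exp_pi_mul_I] at this
    norm_num at this
  obtain ⟨δ, hδ, hδb⟩ : ∃ δ > 0, ∀ z, ‖c - z‖ < δ → (h z).re ≠ 0 := by
    have : ∀ᶠ z in 𝓝 c, (h z).re ≠ 0 :=
      (Complex.continuous_re.comp hdiff.continuous).continuousAt.eventually_ne hc
    obtain ⟨δ, hδ, hb⟩ := Metric.eventually_nhds_iff.mp this
    refine ⟨δ, hδ, fun z hz => hb ?_⟩
    rwa [dist_comm, dist_eq_norm]
  have hδg : ∀ t, δ ≤ ‖c - g t‖ := fun t => by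
    by_contra! hlt
    apply hδb _ hlt
    simp [hg]
  -- critical points are countable
  have hcrit : {z | deriv h z = 0}.Countable := by
    obtain ⟨x, hx⟩ : ∃ x, deriv h x ≠ 0 := by
      by_contra! h0
      have := is_const_of_deriv_eq_zero hdiff h0 (g 0) (g 1)
      simp [hg] at this
      exact Complex.I_ne_zero this.symm
    have han : AnalyticOnNhd ℂ (deriv h) univ := fun z _ => (hdiff.analyticAt z).deriv
    have hm := mem_codiscrete'.mp (han.preimage_zero_mem_codiscrete hx)
    have := hm.2
    have h2 : (deriv h ⁻¹' {0}ᶜ)ᶜ = {z | deriv h z = 0} := by ext z; simp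
    rw [h2] at this
    exact (HereditarilyLindelofSpace.isLindelof _).countable_of_isDiscrete this
  have hae : ∀ᵐ t : ℝ, deriv h (g t) ≠ 0 := by
    have : (g ⁻¹' {z | deriv h z = 0}).Countable := hcrit.preimage hginj
    have := this.measure_zero volume
    rw [ae_iff]
    convert this using 2
    ext t
    simp
  obtain ⟨t₀, ht₀⟩ := hae.exists
  obtain ⟨C, hC⟩ := avg_bound
  have hposint : ∀ R, CircleIntegrable (fun z => log⁺ ‖h z‖) c R := fun R => by
    apply MeromorphicOn.circleIntegrable_posLog_norm
    intro z _
    exact (hdiff.analyticAt z).meromorphicAt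
  have hT : ∀ R, δ ≤ R → circleAverage (fun z => log⁺ ‖h z‖) c R ≤
      log (‖h c‖ + 1) - log δ + log R + C := by
    intro R hR
    apply hC h hdiff.continuous c R _ (hposint R)
    filter_upwards [hae] with t ht htI
    refine (jensen_bound h hdiff (g t) _ c (hg t) (hgu t) ht δ R hδ (hδg t) hR).trans ?_
    have h1 : log ‖h c - Complex.I * t‖ ≤ log (‖h c‖ + 1) := by
      apply Real.log_le_log
      · rw [norm_pos_iff]
        intro h0
        rw [sub_eq_zero] at h0
        apply hc
        simp [h0]
      · refine (norm_sub_le _ _).trans ?_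
        have : ‖Complex.I * (t:ℂ)‖ ≤ 1 := by simp [abs_of_nonneg htI.1.le, htI.2]
        linarith
    linarith
  obtain ⟨f, hfd, hf0, hf⟩ := factor h hdiff (g t₀) _ (hg t₀) (hgu t₀) ht₀
  have hconst := const_of_log_growth f hfd hf0 c
    (log (‖h c‖ + 1) - log δ + C + (log⁺ ‖Complex.I * (t₀ : ℂ)‖ + log 2))
    (max δ (‖g t₀ - c‖ + 1)) (by
      intro R hR
      have hR1 : δ ≤ R := (le_max_left _ _).trans hR
      have hR2 : ‖g t₀ - c‖ + 1 ≤ R := (le_max_right _ _).trans hR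
      have hm : circleAverage (fun z => log⁺ ‖f z‖) c R ≤ circleAverage
          (fun z => log⁺ ‖h z‖ + (log⁺ ‖Complex.I * (t₀ : ℂ)‖ + log 2)) c R := by
        apply circleAverage_mono
        · apply MeromorphicOn.circleIntegrable_posLog_norm
          intro z _
          exact (hfd.analyticAt z).meromorphicAt
        · exact (hposint R).add (circleIntegrable_const _ _ _)
        intro z hz
        rw [abs_of_pos (hδ.trans_le hR1), mem_sphere_iff_norm] at hz
        have h1 : 1 ≤ ‖z - g t₀‖ := by
          have := norm_sub_norm_le (z - c) (g t₀ - c)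
          rw [sub_sub_sub_cancel_right] at this
          linarith
        have h2 : ‖f z‖ ≤ ‖h z - Complex.I * t₀‖ := by
          rw [hf, norm_mul]
          nlinarith [norm_nonneg (f z)]
        have h3 := posLog_le_posLog (norm_nonneg _) h2
        have h4 := posLog_norm_add_le (h z) (-(Complex.I * t₀))
        rw [← sub_eq_add_neg, norm_neg] at h4
        linarith
      rw [circleAverage_fun_add (hposint R) (circleIntegrable_const _ _ _),
        circleAverage_const] at hm
      linarith [hT R hR1])
  refine ⟨f c, Complex.I * t₀ - g t₀ * f c, hf0 c, fun z => ?_⟩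
  have := hf z
  rw [hconst z] at this
  linear_combination this
end

section
/- Let h : ℂ → ℂ be an entire function. Suppose that for every real number t the equation h(z) = i·t has at most one solution z ∈ ℂ. Then h is a polynomial function: there exists a polynomial p with complex coefficients such that h(z) = p(z) for all z ∈ ℂ. -/
open Complex MeasureTheory Real Metric
open scoped Topology

/-- entire functions of polynomial growth are polynomials -/
lemma aux_poly (n : ℕ) : ∀ (f : ℂ → ℂ) (C : ℝ), Differentiable ℂ f →
    (∀ z, ‖f z‖ ≤ C * (1 + ‖z‖) ^ n) → ∃ p : Polynomial ℂ, ∀ z, f z = p.eval z := by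
  induction n with
  | zero =>
    intro f C hf hb
    refine ⟨Polynomial.C (f 0), fun z => ?_⟩
    rw [Polynomial.eval_C]
    apply hf.apply_eq_apply_of_bounded
    rw [isBounded_iff_forall_norm_le]
    refine ⟨C, ?_⟩
    rintro _ ⟨z, rfl⟩
    simpa using hb z
  | succ n ih =>
    intro f C hf hb
    have hd : Differentiable ℂ (dslope f 0) := by
      rw [← differentiableOn_univ] at hf ⊢
      exact (differentiableOn_dslope Filter.univ_mem).2 hf
    obtain ⟨L, hL⟩ := (isCompact_closedBall (0:ℂ) 1).exists_bound_of_continuousOn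
      hd.continuous.continuousOn
    have hC : 0 ≤ C := by
      have := (norm_nonneg _).trans (hb 0)
      simpa using this
    have hL0 : 0 ≤ L := (norm_nonneg _).trans (hL 0 (by simp))
    obtain ⟨p, hp⟩ := ih (dslope f 0) (L + 4 * C) hd (by
      intro z
      have h1 : (1:ℝ) ≤ (1 + ‖z‖) ^ n := one_le_pow₀ (by linarith [norm_nonneg z])
      by_cases hz : ‖z‖ ≤ 1
      · have := hL z (by simpa using hz)
        nlinarith
      · push Not at hz
        have hz0 : z ≠ 0 := by rintro rfl; simp at hz; linarith
        have e := sub_smul_dslope f 0 z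
        have e2 : ‖z‖ * ‖dslope f 0 z‖ = ‖f z - f 0‖ := by
          rw [← e]; simp
        have b1 := hb z
        have b0 : ‖f 0‖ ≤ C := by simpa using hb 0
        have b2 := norm_sub_le (f z) (f 0)
        rw [pow_succ] at b1
        have : ‖z‖ * ‖dslope f 0 z‖ ≤ ‖z‖ * ((L + 4 * C) * (1 + ‖z‖) ^ n) := by
          rw [e2]
          have q1 : C * ((1 + ‖z‖) ^ n * (1 + ‖z‖)) ≤ C * ((1 + ‖z‖) ^ n * (2 * ‖z‖)) := by
            gcongr; linarith
          have q2 : C * 1 ≤ C * ((1 + ‖z‖) ^ n * ‖z‖) := by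
            gcongr
            nlinarith
          have q3 : 0 ≤ L * ((1 + ‖z‖) ^ n * ‖z‖) := by positivity
          have q4 : 0 ≤ C * ((1 + ‖z‖) ^ n * ‖z‖) := by positivity
          nlinarith
        exact le_of_mul_le_mul_left this (by linarith))
    refine ⟨Polynomial.C (f 0) + Polynomial.X * p, fun z => ?_⟩
    have e := sub_smul_dslope f 0 z
    simp only [sub_zero, smul_eq_mul] at e
    simp [← hp, e]

lemma aux_int (w : ℂ) : IntervalIntegrable (fun t : ℝ => Real.log ‖w - I * t‖) volume 0 1 := by
  apply MeromorphicOn.intervalIntegrable_log_norm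
  intro x _
  apply AnalyticAt.meromorphicAt
  have : AnalyticAt ℝ (fun t : ℝ => (t : ℂ)) x := Complex.ofRealCLM.analyticAt x
  fun_prop

lemma aux_lower : ∃ C : ℝ, 0 ≤ C ∧ ∀ w : ℂ,
    log⁺ ‖w‖ - C ≤ ∫ t : ℝ in 0..1, Real.log ‖w - I * t‖ := by
  obtain ⟨M, hM⟩ := (isCompact_Icc (a := (-2:ℝ)) (b := 2)).exists_bound_of_continuousOn
    (f := fun s : ℝ => ∫ t : ℝ in 0..1, Real.log (s - t)) (by
      have : (fun s : ℝ => ∫ t : ℝ in 0..1, Real.log (s - t)) =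
          fun s : ℝ => s * Real.log s - (s - 1) * Real.log (s - 1) - s + (s-1) := by
        ext s
        rw [intervalIntegral.integral_comp_sub_left (fun x => Real.log x)]
        simp
      rw [this]
      have c1 := Real.continuous_mul_log
      have c2 : Continuous fun s : ℝ => (s - 1) * Real.log (s - 1) :=
        c1.comp (continuous_id.sub continuous_const)
      fun_prop)
  have hM0 : 0 ≤ M := (norm_nonneg _).trans (hM 0 (by simp))
  have hl2 : 0 ≤ Real.log 2 := Real.log_nonneg (by norm_num)
  refine ⟨M + Real.log 2, by positivity, fun w => ?_⟩
  by_cases hw : 2 ≤ ‖w‖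
  · have e : log⁺ ‖w‖ = Real.log ‖w‖ := Real.posLog_eq_log (by rw [abs_norm]; linarith)
    have : ∫ t : ℝ in 0..1, (Real.log ‖w‖ - Real.log 2) ≤ ∫ t : ℝ in 0..1, Real.log ‖w - I * t‖ := by
      apply intervalIntegral.integral_mono_on (by norm_num) (by simp) (aux_int w)
      intro t ht
      rw [← Real.log_div (by linarith) (by norm_num)]
      apply Real.log_le_log (by linarith)
      have h1 := norm_sub_norm_le w (I * t)
      have h2 : ‖I * (t:ℂ)‖ ≤ 1 := by simpa [abs_of_nonneg ht.1] using ht.2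
      linarith
    simp at this
    linarith
  · push Not at hw
    have e : log⁺ ‖w‖ ≤ Real.log 2 := by
      have : log⁺ (2:ℝ) = Real.log 2 := Real.posLog_eq_log (by norm_num)
      rw [← this]
      exact Real.monotoneOn_posLog (norm_nonneg w) (by norm_num : (0:ℝ) ≤ 2) hw.le
    have him : |w.im| ≤ 2 := (Complex.abs_im_le_norm w).trans hw.le
    have h3 := hM w.im (abs_le.1 him)
    have : ∫ t : ℝ in 0..1, Real.log (w.im - t) ≤ ∫ t : ℝ in 0..1, Real.log ‖w - I * t‖ := by
      apply intervalIntegral.integral_mono_ae_restrict (by norm_num) ?_ (aux_int w)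
      · have : ∀ᵐ t : ℝ, t ≠ w.im := by
          simp [ae_iff]
        filter_upwards [ae_restrict_of_ae this] with t ht
        rw [← Real.log_abs]
        apply Real.log_le_log (abs_pos.2 (sub_ne_zero.2 ht.symm))
        have := Complex.abs_im_le_norm (w - I * t)
        simpa using this
      · have := (intervalIntegral.intervalIntegrable_log' (a := w.im - 0) (b := w.im - 1)).comp_sub_left w.im
        simpa using this
    rw [Real.norm_eq_abs] at h3
    linarith [(abs_le.1 h3).1]

lemma aux_dslope {h : ℂ → ℂ} (hf : Differentiable ℂ h) (a : ℂ) : Differentiable ℂ (dslope h a) := by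
  rw [← differentiableOn_univ] at hf ⊢
  exact (differentiableOn_dslope Filter.univ_mem).2 hf

lemma aux_avg_ne {g : ℂ → ℂ} (hg : Differentiable ℂ g) (h0 : ∀ z, g z ≠ 0) (R : ℝ) :
    circleAverage (fun z => Real.log ‖g z‖) 0 R = Real.log ‖g 0‖ :=
  AnalyticOnNhd.circleAverage_log_norm_of_ne_zero (fun x _ => hg.analyticAt x) (fun u _ => h0 u)

/-- the value `I * t` is omitted or taken exactly once, with multiplicity one -/
def AuxGood (h : ℂ → ℂ) (t : ℝ) : Prop :=
  (∀ z, h z ≠ I * t) ∨ ∃ z₀, h z₀ = I * t ∧ ∀ z, dslope h z₀ z ≠ 0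

lemma aux_upper (h : ℂ → ℂ) (hf : Differentiable ℂ h) : ∃ C : ℝ, ∀ t : ℝ, 0 ≤ t → t ≤ 1 →
    AuxGood h t → ∀ R : ℝ, 1 ≤ R →
    circleAverage (fun z => Real.log ‖h z - I * t‖) 0 R ≤ Real.log R + C := by
  obtain ⟨L, hL⟩ := (isCompact_closedBall (0:ℂ) 1).exists_bound_of_continuousOn
      (aux_dslope hf 0).continuous.continuousOn
  have hL0 : 0 ≤ L := (norm_nonneg _).trans (hL 0 (by simp))
  have hA : 1 ≤ L + ‖h 0‖ + 1 := by linarith [norm_nonneg (h 0)]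
  refine ⟨Real.log (L + ‖h 0‖ + 1), fun t ht0 ht1 hg R hR => ?_⟩
  have hlR : 0 ≤ Real.log R := Real.log_nonneg hR
  have hIt : ‖I * (t:ℂ)‖ ≤ 1 := by simpa [abs_of_nonneg ht0] using ht1
  have hh0 : ‖h 0 - I * t‖ ≤ ‖h 0‖ + 1 := (norm_sub_le _ _).trans (by linarith)
  rcases hg with hg | ⟨z₀, hz₀, hg⟩
  · have hz : ∀ z, h z - I * t ≠ 0 := fun z => sub_ne_zero.2 (hg z)
    rw [aux_avg_ne (g := fun z => h z - I * t) (by fun_prop) hz R]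
    have := Real.log_le_log (norm_pos_iff.2 (hz 0)) (hh0.trans (by linarith : _ ≤ L + ‖h 0‖ + 1))
    linarith
  · have hR0 : R ≠ 0 := by linarith
    have e1 : circleAverage (fun z => Real.log ‖h z - I * t‖) 0 R =
        circleAverage ((fun z => Real.log ‖z - z₀‖) + (fun z => Real.log ‖dslope h z₀ z‖)) 0 R := by
      apply circleAverage_congr_codiscreteWithin _ hR0
      filter_upwards [compl_singleton_mem_codiscreteWithin (x := z₀)] with z hz
      have hz : z ≠ z₀ := hz
      have e := sub_smul_dslope h z₀ z
      rw [hz₀] at e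
      rw [← e, smul_eq_mul, norm_mul, Real.log_mul]
      · rfl
      · exact norm_ne_zero_iff.2 (sub_ne_zero.2 hz)
      · exact norm_ne_zero_iff.2 (hg z)
    have ci : CircleIntegrable (fun z => Real.log ‖dslope h z₀ z‖) 0 R := by
      apply MeromorphicOn.circleIntegrable_log_norm
      exact fun z _ => ((aux_dslope hf z₀).analyticAt z).meromorphicAt
    rw [e1, circleAverage_add (circleIntegrable_log_norm_sub_const R) ci,
      aux_avg_ne (aux_dslope hf z₀) hg R,
      circleAverage_log_norm_sub_const_eq_log_radius_add_posLog hR0, zero_sub, norm_neg]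
    have hp := norm_pos_iff.2 (hg 0)
    by_cases hz1 : ‖z₀‖ ≤ 1
    · have e2 : log⁺ (R⁻¹ * ‖z₀‖) = 0 := by
        rw [Real.posLog_eq_zero_iff, abs_of_nonneg (by positivity)]
        have : R⁻¹ ≤ 1 := inv_le_one_of_one_le₀ hR
        have : 0 ≤ R⁻¹ := by positivity
        nlinarith [norm_nonneg z₀]
      have e3 : dslope h z₀ 0 = dslope h 0 z₀ := by
        by_cases h0 : z₀ = 0
        · rw [h0]
        · rw [dslope_of_ne _ h0, dslope_of_ne _ (Ne.symm h0), slope_comm]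
      have e4 := hL z₀ (by simpa using hz1)
      rw [← e3] at e4
      have := Real.log_le_log hp (e4.trans (by linarith [norm_nonneg (h 0)] : _ ≤ L + ‖h 0‖ + 1))
      linarith
    · push Not at hz1
      have e := sub_smul_dslope h z₀ 0
      rw [hz₀, zero_sub, neg_smul] at e
      have e5 : ‖z₀‖ * ‖dslope h z₀ 0‖ = ‖h 0 - I * t‖ := by rw [← e]; simp
      have e6 : log⁺ (R⁻¹ * ‖z₀‖) ≤ Real.log ‖z₀‖ := by
        have : log⁺ ‖z₀‖ = Real.log ‖z₀‖ := Real.posLog_eq_log (by rw [abs_norm]; linarith)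
        rw [← this]
        have h1 : R⁻¹ ≤ 1 := inv_le_one_of_one_le₀ hR
        exact Real.monotoneOn_posLog (show (0:ℝ) ≤ R⁻¹ * ‖z₀‖ by positivity) (norm_nonneg z₀)
          (mul_le_of_le_one_left (norm_nonneg _) h1)
      have e7 : Real.log ‖z₀‖ + Real.log ‖dslope h z₀ 0‖ ≤ Real.log (L + ‖h 0‖ + 1) := by
        rw [← Real.log_mul (by linarith) hp.ne', e5]
        apply Real.log_le_log _ (by linarith)
        rw [← e5]; positivity
      linarith

lemma aux_fubini (h : ℂ → ℂ) (hf : Differentiable ℂ h) (hgood : ∀ᵐ t : ℝ, AuxGood h t) :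
    ∃ C : ℝ, 0 ≤ C ∧ ∀ R : ℝ, 1 ≤ R →
    circleAverage (fun z => log⁺ ‖h z‖) 0 R ≤ Real.log R + C := by
  obtain ⟨C₁, hC₁⟩ := aux_upper h hf
  obtain ⟨C₀, hC₀, hlow⟩ := aux_lower
  refine ⟨|C₁| + C₀, by positivity, fun R hR => ?_⟩
  set μ : Measure ℝ := volume.restrict (Set.Ioc 0 (2 * π)) with hμ
  set ν : Measure ℝ := volume.restrict (Set.Ioc 0 1) with hν
  have hνr : ν.real Set.univ = 1 := by simp [hν, measureReal_def]
  have hμr : μ.real Set.univ = 2 * π := by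
    simp [hμ, measureReal_def, Real.pi_pos.le]
  let F : ℝ → ℝ → ℝ := fun θ t => Real.log ‖h (circleMap 0 R θ) - I * t‖
  have hcont := hf.continuous
  have hFi : ∀ θ, Integrable (F θ) ν := fun θ => by
    have := aux_int (h (circleMap 0 R θ))
    rwa [intervalIntegrable_iff_integrableOn_Ioc_of_le (by norm_num)] at this
  have hFl : ∀ θ, log⁺ ‖h (circleMap 0 R θ)‖ - C₀ ≤ ∫ t, F θ t ∂ν := fun θ => by
    have := hlow (h (circleMap 0 R θ))
    rwa [intervalIntegral.integral_of_le (by norm_num)] at this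
  obtain ⟨M, hM⟩ := (isCompact_closedBall (0:ℂ) R).exists_bound_of_continuousOn
      hcont.continuousOn
  have hM0 : 0 ≤ M := (norm_nonneg _).trans (hM 0 (by simp; linarith))
  have hFu : ∀ θ, ∀ t ∈ Set.Ioc (0:ℝ) 1, F θ t ≤ M + 1 := fun θ t ht => by
    have h1 : ‖h (circleMap 0 R θ)‖ ≤ M := hM _ (by
      simp [abs_of_nonneg (by linarith : 0 ≤ R)])
    have hIt : ‖I * (t:ℂ)‖ ≤ 1 := by simpa [abs_of_nonneg ht.1.le] using ht.2
    have h2 := norm_sub_le (h (circleMap 0 R θ)) (I * t)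
    have h3 := Real.log_le_self (norm_nonneg (h (circleMap 0 R θ) - I * t))
    show Real.log _ ≤ _
    linarith
  have hmeas : Measurable (Function.uncurry F) := by
    have c : Continuous fun p : ℝ × ℝ => ‖h (circleMap 0 R p.1) - I * (p.2 : ℂ)‖ := by
      have := continuous_circleMap 0 R
      fun_prop
    exact Real.measurable_log.comp c.measurable
  have hint : Integrable (Function.uncurry F) (μ.prod ν) := by
    rw [integrable_prod_iff hmeas.aestronglyMeasurable]
    refine ⟨.of_forall fun θ => hFi θ, ?_⟩
    apply Integrable.of_bound
      (hmeas.norm.aestronglyMeasurable (μ := μ.prod ν)).integral_prod_right' (2 * (M + 1) + C₀)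
    filter_upwards with θ
    rw [Real.norm_of_nonneg (integral_nonneg fun _ => norm_nonneg _)]
    have : ∫ t, ‖F θ t‖ ∂ν ≤ ∫ t, (2 * (M + 1) - F θ t) ∂ν := by
      apply integral_mono_ae (hFi θ).norm ((integrable_const _).sub (hFi θ))
      filter_upwards [ae_restrict_mem measurableSet_Ioc] with t ht
      have := hFu θ t ht
      simp only [Real.norm_eq_abs, Pi.sub_apply]
      apply abs_le.2 ⟨?_, ?_⟩ <;> linarith
    rw [integral_sub (integrable_const _) (hFi θ), integral_const, hνr] at this
    have h2 := hFl θ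
    have h3 := Real.posLog_nonneg (x := ‖h (circleMap 0 R θ)‖)
    simp only [smul_eq_mul, one_mul] at this
    refine le_trans this ?_
    linarith
  have hswap := integral_integral_swap hint
  have hpl : Continuous fun θ : ℝ => log⁺ ‖h (circleMap 0 R θ)‖ := by
    have := continuous_circleMap 0 R
    fun_prop
  have hpli : Integrable (fun θ : ℝ => log⁺ ‖h (circleMap 0 R θ)‖) μ :=
    (hpl.integrableOn_Icc).mono_set Set.Ioc_subset_Icc_self
  have hL : (∫ θ, log⁺ ‖h (circleMap 0 R θ)‖ ∂μ) - 2 * π * C₀ ≤ ∫ θ, ∫ t, F θ t ∂ν ∂μ := by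
    have : ∫ θ, (log⁺ ‖h (circleMap 0 R θ)‖ - C₀) ∂μ ≤ ∫ θ, ∫ t, F θ t ∂ν ∂μ :=
      integral_mono (hpli.sub (integrable_const _)) hint.integral_prod_left hFl
    rwa [integral_sub hpli (integrable_const _), integral_const, hμr, smul_eq_mul] at this
  have hU : ∫ t, ∫ θ, F θ t ∂μ ∂ν ≤ 2 * π * (Real.log R + C₁) := by
    have : ∫ t, ∫ θ, F θ t ∂μ ∂ν ≤ ∫ t, 2 * π * (Real.log R + C₁) ∂ν := by
      apply integral_mono_ae hint.integral_prod_right (integrable_const _)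
      filter_upwards [ae_restrict_mem measurableSet_Ioc, ae_restrict_of_ae hgood] with t ht hg
      have := hC₁ t ht.1.le ht.2 hg R hR
      rw [circleAverage, intervalIntegral.integral_of_le (by positivity), smul_eq_mul,
        inv_mul_le_iff₀ (by positivity)] at this
      exact this
    rwa [integral_const, hνr, one_smul] at this
  rw [circleAverage, intervalIntegral.integral_of_le (by positivity), smul_eq_mul,
        inv_mul_le_iff₀ (by positivity)]
  have : 2 * π * C₁ ≤ 2 * π * |C₁| := by gcongr; exact le_abs_self _
  rw [hswap] at hL
  linarith

lemma aux_poisson (g : ℂ → ℂ) (hg : Differentiable ℂ g) (h0 : ∀ z, g z ≠ 0) (R : ℝ) (hR : 0 < R)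
    (w : ℂ) (hw : 2 * ‖w‖ ≤ R) :
    Real.log ‖g w‖ ≤ 3 * circleAverage (fun z => log⁺ ‖g z‖) 0 R := by
  have hwb : w ∈ ball (0:ℂ) R := by simp; linarith [norm_nonneg w]
  have hh : InnerProductSpace.HarmonicOnNhd (fun z => Real.log ‖g z‖) (closedBall 0 R) :=
    fun x _ => (hg.analyticAt x).harmonicAt_log_norm (h0 x)
  rw [← hh.circleAverage_re_herglotzRieszKernel_smul hwb, ← smul_eq_mul, ← circleAverage_fun_smul]
  have hgc := hg.continuous
  have hlc : Continuous fun z => Real.log ‖g z‖ :=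
    hgc.norm.log fun z => norm_ne_zero_iff.2 (h0 z)
  apply circleAverage_mono
  · apply ContinuousOn.circleIntegrable hR.le
    apply ContinuousOn.smul _ hlc.continuousOn
    apply Complex.continuous_re.comp_continuousOn
    rw [herglotzRieszKernel_fun_def]
    apply ContinuousOn.div (by fun_prop) (by fun_prop)
    intro x hx
    simp only [sub_zero]
    rw [sub_ne_zero]
    rintro rfl
    simp at hx hwb
    linarith
  · apply Continuous.continuousOn _ |>.circleIntegrable hR.le
    fun_prop
  · intro z hz
    rw [abs_of_pos hR] at hz
    have k1 := re_herglotzRieszKernel_le hz hwb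
    have k2 := le_re_herglotzRieszKernel hz hwb
    have k3 : (R + ‖w - 0‖) / (R - ‖w - 0‖) ≤ 3 := by
      rw [sub_zero, div_le_iff₀ (by linarith [norm_nonneg w])]
      linarith
    have k4 : 0 ≤ (R - ‖w - 0‖) / (R + ‖w - 0‖) := by
      rw [sub_zero]
      apply div_nonneg <;> linarith [norm_nonneg w]
    have k5 : Real.log ‖g z‖ ≤ log⁺ ‖g z‖ := by rw [Real.posLog]; exact le_max_right _ _
    have k6 := Real.posLog_nonneg (x := ‖g z‖)
    simp only [Pi.smul_apply', Function.comp_apply, smul_eq_mul, herglotzRieszKernel_def]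
    exact (mul_le_mul_of_nonneg_left k5 (k4.trans k2)).trans
      (mul_le_mul_of_nonneg_right (k1.trans k3) k6)

lemma aux_growth (g : ℂ → ℂ) (hg : Differentiable ℂ g) (h0 : ∀ z, g z ≠ 0) (R₀ C : ℝ) (hR₀ : 1 ≤ R₀)
    (hb : ∀ R, R₀ ≤ R → circleAverage (fun z => log⁺ ‖g z‖) 0 R ≤ Real.log R + C) :
    ∃ p : Polynomial ℂ, ∀ z, g z = p.eval z := by
  apply aux_poly 3 g (Real.exp (3 * C) * (2 * R₀) ^ 3) hg
  intro w
  have hn := norm_nonneg w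
  have hRp : 0 < R₀ + 2 * ‖w‖ := by linarith
  have h1 := aux_poisson g hg h0 (R₀ + 2 * ‖w‖) hRp w (by linarith)
  have h2 := hb (R₀ + 2 * ‖w‖) (by linarith)
  have h3 : Real.log ‖g w‖ ≤ 3 * C + 3 * Real.log (R₀ + 2 * ‖w‖) := by linarith
  have h4 : ‖g w‖ ≤ Real.exp (3 * C) * (R₀ + 2 * ‖w‖) ^ 3 := by
    rw [← Real.exp_log (norm_pos_iff.2 (h0 w))]
    refine (Real.exp_le_exp.2 h3).trans_eq ?_
    rw [Real.exp_add]
    congr 1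
    rw [← Real.exp_log (pow_pos hRp 3), Real.log_pow]
    norm_num
  refine h4.trans ?_
  rw [mul_assoc, ← mul_pow]
  gcongr
  nlinarith

lemma aux_countable (f : ℂ → ℂ) (hf : Differentiable ℂ f) (hne : ∃ z, f z ≠ 0) :
    {z | f z = 0}.Countable := by
  have : DiscreteTopology {z | f z = 0} := by
    rw [discreteTopology_subtype_iff]
    intro x hx
    rcases (hf.analyticAt x).eventually_eq_zero_or_eventually_ne_zero with h | h
    · exfalso
      obtain ⟨z, hz⟩ := hne
      apply hz
      have := AnalyticOnNhd.eqOn_zero_of_preconnected_of_eventuallyEq_zero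
        (U := Set.univ) (fun x _ => hf.analyticAt x) isPreconnected_univ (Set.mem_univ x) h
      exact this (Set.mem_univ z)
    · rw [← disjoint_iff, Filter.disjoint_principal_right]
      exact h
  have h2 : Countable {z | f z = 0} := TopologicalSpace.separableSpace_iff_countable.1 inferInstance
  exact Set.countable_coe_iff.1 h2

lemma aux_good (h : ℂ → ℂ) (hdiff : Differentiable ℂ h)
    (hinj : ∀ t : ℝ, ∀ z w : ℂ, h z = Complex.I * t → h w = Complex.I * t → z = w)
    (hne : ∃ z, deriv h z ≠ 0) : ∀ᵐ t : ℝ, AuxGood h t := by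
  have hd : Differentiable ℂ (deriv h) := by
    have := (hdiff.differentiableOn (s := Set.univ)).deriv isOpen_univ
    exact differentiableOn_univ.1 this
  have hc := (aux_countable _ hd hne).image (fun z => (h z).im)
  filter_upwards [hc.ae_notMem volume] with t ht
  by_cases hz : ∀ z, h z ≠ I * t
  · exact Or.inl hz
  · push Not at hz
    obtain ⟨z₀, hz₀⟩ := hz
    refine Or.inr ⟨z₀, hz₀, fun z hz => ?_⟩
    by_cases e : z = z₀
    · subst e
      rw [dslope_same] at hz
      exact ht ⟨z, hz, by simp [hz₀]⟩
    · have e2 := sub_smul_dslope h z₀ z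
      rw [hz, smul_zero, hz₀] at e2
      exact e (hinj t z z₀ (sub_eq_zero.1 e2.symm) hz₀)

/-- If an entire function `h : ℂ → ℂ` takes each purely imaginary value `i·t`
(for `t : ℝ`) at most once, then `h` is a polynomial function. -/
theorem entire_atMostOne_imaginary_values_polynomial (h : ℂ → ℂ)
    (hdiff : Differentiable ℂ h)
    (hinj : ∀ t : ℝ, ∀ z w : ℂ, h z = Complex.I * t → h w = Complex.I * t → z = w) :
    ∃ p : Polynomial ℂ, ∀ z : ℂ, h z = p.eval z := by
  by_cases hne : ∃ z, deriv h z ≠ 0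
  swap
  · push Not at hne
    exact ⟨Polynomial.C (h 0), fun z => by
      rw [Polynomial.eval_C]; exact is_const_of_deriv_eq_zero hdiff hne z 0⟩
  have hgood := aux_good h hdiff hinj hne
  obtain ⟨C, hC, hb⟩ := aux_fubini h hdiff hgood
  obtain ⟨t, ht⟩ := hgood.exists
  have hcont := hdiff.continuous
  have key : ∀ (g : ℂ → ℂ) (R₀ : ℝ), Differentiable ℂ g → (∀ z, g z ≠ 0) → 1 ≤ R₀ →
      (∀ z, R₀ ≤ ‖z‖ → ‖g z‖ ≤ ‖h z - I * t‖) → ∃ p : Polynomial ℂ, ∀ z, g z = p.eval z := by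
    intro g R₀ hg h0 hR₀ hle
    have hgc := hg.continuous
    apply aux_growth g hg h0 R₀ (C + (log⁺ ‖-(I * (t:ℂ))‖ + Real.log 2)) hR₀
    intro R hR
    have h1 := hb R (hR₀.trans hR)
    have hRp : 0 ≤ R := by linarith
    have i1 : CircleIntegrable (fun z => log⁺ ‖g z‖) 0 R :=
      Continuous.continuousOn (by fun_prop) |>.circleIntegrable hRp
    have i2 : CircleIntegrable (fun z => log⁺ ‖h z‖) 0 R :=
      Continuous.continuousOn (by fun_prop) |>.circleIntegrable hRp
    have i3 : CircleIntegrable (fun z : ℂ => log⁺ ‖-(I * (t:ℂ))‖ + Real.log 2) 0 R :=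
      Continuous.continuousOn (by fun_prop) |>.circleIntegrable hRp
    have h2 : circleAverage (fun z => log⁺ ‖g z‖) 0 R ≤
        circleAverage (fun z => log⁺ ‖h z‖ + (log⁺ ‖-(I * (t:ℂ))‖ + Real.log 2)) 0 R := by
      apply circleAverage_mono i1 (i2.add i3)
      intro z hz
      have hz' : R₀ ≤ ‖z‖ := by
        rw [mem_sphere_zero_iff_norm, abs_of_nonneg hRp] at hz
        linarith
      have h3 := Real.posLog_norm_add_le (h z) (-(I * (t:ℂ)))
      rw [← sub_eq_add_neg] at h3
      have h4 := Real.monotoneOn_posLog (norm_nonneg (g z)) (norm_nonneg _) (hle z hz')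
      simp only [Pi.add_apply]
      linarith
    rw [circleAverage_fun_add i2 i3, circleAverage_const] at h2
    linarith
  rcases ht with ht | ⟨z₀, hz₀, ht⟩
  · obtain ⟨p, hp⟩ := key (fun z => h z - I * t) 1 (by fun_prop) (fun z => sub_ne_zero.2 (ht z))
      le_rfl (fun z _ => le_rfl)
    refine ⟨p + Polynomial.C (I * t), fun z => ?_⟩
    simp [← hp]
  · obtain ⟨p, hp⟩ := key (dslope h z₀) (1 + ‖z₀‖) (aux_dslope hdiff z₀) ht
      (by linarith [norm_nonneg z₀]) (fun z hz => by
        have e := sub_smul_dslope h z₀ z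
        rw [← hz₀, ← e, norm_smul]
        have := norm_sub_norm_le z z₀
        exact le_mul_of_one_le_left (norm_nonneg _) (by linarith))
    refine ⟨(Polynomial.X - Polynomial.C z₀) * p + Polynomial.C (h z₀), fun z => ?_⟩
    have e := sub_smul_dslope h z₀ z
    rw [smul_eq_mul] at e
    simp [← hp, e]
end
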